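/- Let N ≥ 2 and let Σ ⊂ ℝ^N be a nonempty compact connected set which is an (N−1)-dimensional embedded topological submanifold of ℝ^N without boundary, i.e. every point x ∈ Σ has an open neighborhood U ⊆ ℝ^N and a homeomorphism h from U onto an open set V ⊆ ℝ^N with h(U ∩ Σ) = V ∩ (ℝ^{N−1} × {0}). Then the complement ℝ^N \ Σ has exactly two connected components: one of them is bounded and the other is unbounded, and the topological frontier (boundary) of each of the two components is exactly Σ. -/

import Mathlib

open Set Filter Topology Metric

/-- The open set `W` is cut by `S` into two connected sides `A` and `B`, each of which accumulates
at every point of `W ∩ S`. -/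
structure IsCut {X : Type*} [TopologicalSpace X] (S W A B : Set X) : Prop where
  isOpen : IsOpen W
  isOpen_left : IsOpen A
  isOpen_right : IsOpen B
  left_preconnected : IsPreconnected A
  right_preconnected : IsPreconnected B
  disjoint : Disjoint A B
  union_eq : A ∪ B = W \ S
  subset_closure_left : W ∩ S ⊆ closure A
  subset_closure_right : W ∩ S ⊆ closure B

/-- Every point of `S` has arbitrarily small neighborhoods which `S` cuts into two sides. -/
def LocallySeparating {X : Type*} [TopologicalSpace X] (S : Set X) : Prop :=
  ∀ x ∈ S, ∀ O ∈ 𝓝 x, ∃ W A B, IsCut S W A B ∧ x ∈ W ∧ W ⊆ O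

/-- A function on the open set `O` which is locally constant off `S` and takes both values
near every point of `S`. -/
structure IsSideFunction {X : Type*} [TopologicalSpace X] (S O : Set X) (f : X → Bool) : Prop where
  isOpen : IsOpen O
  eventually_eq : ∀ x ∈ O \ S, ∀ᶠ y in 𝓝 x, f y = f x
  frequently_eq : ∀ x ∈ O ∩ S, ∀ b, ∃ᶠ y in 𝓝[Sᶜ] x, f y = b

section General

variable {X : Type*} [TopologicalSpace X] {S W A B O O' : Set X} {f f' : X → Bool} {x y : X}

lemma IsCut.left_subset (h : IsCut S W A B) : A ⊆ W \ S :=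
  h.union_eq ▸ subset_union_left

lemma IsCut.right_subset (h : IsCut S W A B) : B ⊆ W \ S :=
  h.union_eq ▸ subset_union_right

lemma IsSideFunction.mono (h : IsSideFunction S O f) (hO' : IsOpen O') (hsub : O' ⊆ O) :
    IsSideFunction S O' f :=
  ⟨hO', fun x hx => h.eventually_eq x ⟨hsub hx.1, hx.2⟩,
    fun x hx => h.frequently_eq x ⟨hsub hx.1, hx.2⟩⟩

lemma IsSideFunction.congr (h : IsSideFunction S O f) (hcl : IsClosed S)
    (hff' : ∀ x ∈ O \ S, f' x = f x) : IsSideFunction S O f' := by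
  refine ⟨h.isOpen, fun x hx => ?_, fun x hx b => ?_⟩
  · filter_upwards [h.eventually_eq x hx, (h.isOpen.sdiff hcl).mem_nhds hx] with y hy hyO
    rw [hff' y hyO, hff' x hx, hy]
  · have hO : ∀ᶠ y in 𝓝[Sᶜ] x, y ∈ O \ S := by
      filter_upwards [mem_nhdsWithin_of_mem_nhds (h.isOpen.mem_nhds hx.1), self_mem_nhdsWithin]
        with y hy hyS using ⟨hy, hyS⟩
    refine ((h.frequently_eq x hx b).and_eventually hO).mono fun y hy => ?_
    rw [hff' y hy.2, hy.1]

lemma IsSideFunction.union (h : IsSideFunction S O f) (h' : IsSideFunction S O' f) :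
    IsSideFunction S (O ∪ O') f :=
  ⟨h.isOpen.union h'.isOpen,
    fun x hx => hx.1.elim (fun hO => h.eventually_eq x ⟨hO, hx.2⟩)
      fun hO => h'.eventually_eq x ⟨hO, hx.2⟩,
    fun x hx => hx.1.elim (fun hO => h.frequently_eq x ⟨hO, hx.2⟩)
      fun hO => h'.frequently_eq x ⟨hO, hx.2⟩⟩

lemma IsSideFunction.xor (h : IsSideFunction S O f) (b : Bool) :
    IsSideFunction S O (fun x => b ^^ f x) := by
  refine ⟨h.isOpen, fun x hx => ?_, fun x hx c => ?_⟩
  · filter_upwards [h.eventually_eq x hx] with y hy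
    rw [hy]
  · refine (h.frequently_eq x hx (b ^^ c)).mono fun y hy => ?_
    simp [hy]

lemma IsSideFunction.eq_of_isPreconnected {T : Set X} (h : IsSideFunction S O f)
    (hT : IsPreconnected T) (hTO : T ⊆ O \ S) (hx : x ∈ T) (hy : y ∈ T) : f x = f y := by
  refine hT.constant (f := f) (fun z hz => ?_) hx hy
  have : ContinuousAt f z := continuousAt_const.congr
    ((h.eventually_eq z (hTO hz)).mono fun w hw => hw.symm)
  exact this.continuousWithinAt

lemma IsCut.exists_sideFunction (h : IsCut S W A B) : ∃ f, IsSideFunction S W f := by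
  classical
  have hB : ∀ y ∈ B, y ∉ A := fun y hy hyA => h.disjoint.le_bot ⟨hyA, hy⟩
  refine ⟨fun y => decide (y ∈ A), h.isOpen, fun x hx => ?_, fun x hx b => ?_⟩
  · rw [← h.union_eq] at hx
    rcases hx with hx | hx
    · filter_upwards [h.isOpen_left.mem_nhds hx] with y hy
      simp [hx, hy]
    · filter_upwards [h.isOpen_right.mem_nhds hx] with y hy
      simp [hB _ hx, hB _ hy]
  · rw [frequently_nhdsWithin_iff]
    cases b
    · refine (mem_closure_iff_frequently.1 (h.subset_closure_right hx)).mono fun y hy => ?_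
      exact ⟨by simp [hB y hy], (h.right_subset hy).2⟩
    · refine (mem_closure_iff_frequently.1 (h.subset_closure_left hx)).mono fun y hy => ?_
      exact ⟨by simp [hy], (h.left_subset hy).2⟩

/-- A side function takes opposite values on the two sides of a cut. -/
lemma IsCut.sideFunction_ne (h : IsCut S W A B) (hf : IsSideFunction S W f)
    (hxW : x ∈ W) (hxS : x ∈ S) {a b : X} (ha : a ∈ A) (hb : b ∈ B) : f a = !f b := by
  by_contra hne
  have hab : f a = f b := by simpa using hne
  have hall : ∀ y ∈ W \ S, f y = f a := fun y hy => by
    rw [← h.union_eq] at hy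
    rcases hy with hy | hy
    · exact hf.eq_of_isPreconnected h.left_preconnected h.left_subset hy ha
    · exact (hf.eq_of_isPreconnected h.right_preconnected h.right_subset hy hb).trans hab.symm
  refine hf.frequently_eq x ⟨hxW, hxS⟩ (!f a) ?_
  filter_upwards [mem_nhdsWithin_of_mem_nhds (h.isOpen.mem_nhds hxW), self_mem_nhdsWithin]
    with y hy hyS
  simp [hall y ⟨hy, hyS⟩]

lemma IsCut.left_nonempty (h : IsCut S W A B) (hxW : x ∈ W) (hxS : x ∈ S) : A.Nonempty :=
  closure_nonempty_iff.1 ⟨x, h.subset_closure_left ⟨hxW, hxS⟩⟩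

lemma IsCut.right_nonempty (h : IsCut S W A B) (hxW : x ∈ W) (hxS : x ∈ S) : B.Nonempty :=
  closure_nonempty_iff.1 ⟨x, h.subset_closure_right ⟨hxW, hxS⟩⟩

lemma LocallySeparating.neBot (hS : LocallySeparating S) (x : X) : (𝓝[Sᶜ] x).NeBot := by
  rw [← mem_closure_iff_nhdsWithin_neBot]
  by_cases hx : x ∈ S
  · obtain ⟨W, A, B, h, hxW, -⟩ := hS x hx univ univ_mem
    exact closure_mono (fun y hy => (h.left_subset hy).2) (h.subset_closure_left ⟨hxW, hx⟩)
  · exact subset_closure hx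

/-- Two side functions agree up to a global sign near each point. -/
lemma LocallySeparating.exists_eventually_eq_xor (hS : LocallySeparating S)
    (hf : IsSideFunction S O f) (hf' : IsSideFunction S O f') (hx : x ∈ O) :
    ∃ b, ∀ᶠ y in 𝓝[Sᶜ] x, f y = (b ^^ f' y) := by
  by_cases hxS : x ∈ S
  · obtain ⟨W, A, B, h, hxW, hWO⟩ := hS x hxS O (hf.isOpen.mem_nhds hx)
    replace hf := hf.mono h.isOpen hWO
    replace hf' := hf'.mono h.isOpen hWO
    obtain ⟨a, ha⟩ := h.left_nonempty hxW hxS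
    obtain ⟨b, hb⟩ := h.right_nonempty hxW hxS
    refine ⟨f a ^^ f' a, ?_⟩
    filter_upwards [mem_nhdsWithin_of_mem_nhds (h.isOpen.mem_nhds hxW), self_mem_nhdsWithin]
      with y hy hyS
    have hy' : y ∈ A ∪ B := h.union_eq ▸ ⟨hy, hyS⟩
    rcases hy' with hy' | hy'
    · rw [hf.eq_of_isPreconnected h.left_preconnected h.left_subset hy' ha,
        hf'.eq_of_isPreconnected h.left_preconnected h.left_subset hy' ha]
      simp
    · rw [h.sideFunction_ne hf hxW hxS ha hy', h.sideFunction_ne hf' hxW hxS ha hy']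
      simp
  · refine ⟨f x ^^ f' x, mem_nhdsWithin_of_mem_nhds ?_⟩
    filter_upwards [hf.eventually_eq x ⟨hx, hxS⟩, hf'.eventually_eq x ⟨hx, hxS⟩] with y h1 h2
    simp [h1, h2]

/-- Two side functions on a connected open set agree up to a global sign. -/
lemma LocallySeparating.exists_eq_xor (hS : LocallySeparating S) (hO : IsPreconnected O)
    (hf : IsSideFunction S O f) (hf' : IsSideFunction S O f') :
    ∃ b, ∀ y ∈ O \ S, f y = (b ^^ f' y) := by
  let D : Bool → Set X := fun b => {x | ∀ᶠ y in 𝓝[Sᶜ] x, f y = (b ^^ f' y)}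
  have hD : ∀ b, IsOpen (D b) := fun b => by
    simp only [D, eventually_nhdsWithin_iff]
    exact isOpen_setOfPred_eventually_nhds
  have hdisj : Disjoint (D true) (D false) := by
    rw [Set.disjoint_left]
    intro x h1 h2
    have := hS.neBot x
    obtain ⟨y, h1, h2⟩ := (Filter.Eventually.and (show ∀ᶠ y in 𝓝[Sᶜ] x, _ from h1) h2).exists
    rw [h1] at h2
    simp at h2
  have hcov : O ⊆ D true ∪ D false := fun x hx => by
    obtain ⟨b, hb⟩ := hS.exists_eventually_eq_xor hf hf' hx
    cases b
    · exact Or.inr hb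
    · exact Or.inl hb
  have key : ∀ b, O ⊆ D b → ∀ y ∈ O \ S, f y = (b ^^ f' y) := fun b hb y hy =>
    (eventually_nhdsWithin_iff.1 (hb hy.1)).self_of_nhds hy.2
  rcases hO.subset_or_subset (hD true) (hD false) hdisj hcov with h | h
  · exact ⟨true, key _ h⟩
  · exact ⟨false, key _ h⟩

end General

section Extension

variable {E : Type*} [NormedAddCommGroup E] [NormedSpace ℝ E] {S K : Set E}

/-- Side functions near the two halves of a compact convex set glue. -/
lemma LocallySeparating.glue (hS : LocallySeparating S) (hcl : IsClosed S) (hK : IsCompact K)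
    (hconv : Convex ℝ K) (l : E →L[ℝ] ℝ) (c : ℝ)
    (h₁ : ∃ O f, K ∩ {x | l x ≤ c} ⊆ O ∧ IsSideFunction S O f)
    (h₂ : ∃ O f, K ∩ {x | c ≤ l x} ⊆ O ∧ IsSideFunction S O f) :
    ∃ O f, K ⊆ O ∧ IsSideFunction S O f := by
  classical
  obtain ⟨O₁, f₁, hKO₁, hf₁⟩ := h₁
  obtain ⟨O₂, f₂, hKO₂, hf₂⟩ := h₂
  have hc : IsCompact (K ∩ {x | l x = c}) :=
    hK.inter_right (isClosed_eq l.continuous continuous_const)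
  obtain ⟨δ, hδ, hsub⟩ := hc.exists_thickening_subset_open (hf₁.isOpen.inter hf₂.isOpen)
    (fun x hx => ⟨hKO₁ ⟨hx.1, le_of_eq hx.2⟩, hKO₂ ⟨hx.1, ge_of_eq hx.2⟩⟩)
  set W := thickening δ (K ∩ {x | l x = c})
  have hWo : IsOpen W := isOpen_thickening
  have hWconv : Convex ℝ W :=
    (hconv.inter (convex_hyperplane l.toLinearMap.isLinear c)).thickening δ
  obtain ⟨b, hb⟩ := hS.exists_eq_xor hWconv.isPreconnected
    (hf₁.mono hWo fun x hx => (hsub hx).1) (hf₂.mono hWo fun x hx => (hsub hx).2)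
  have hlt : IsOpen {x | l x < c} := isOpen_lt l.continuous continuous_const
  have hgt : IsOpen {x | c < l x} := isOpen_lt continuous_const l.continuous
  let f : E → Bool := fun x => if l x ≤ c then f₁ x else b ^^ f₂ x
  have hL : IsSideFunction S (O₁ ∩ {x | l x < c}) f :=
    (hf₁.mono (hf₁.isOpen.inter hlt) inter_subset_left).congr hcl fun x hx => by
      simp [f, le_of_lt (show l x < c from hx.1.2)]
  have hR : IsSideFunction S (O₂ ∩ {x | c < l x}) f :=
    ((hf₂.xor b).mono (hf₂.isOpen.inter hgt) inter_subset_left).congr hcl fun x hx => by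
      simp [f, not_le_of_gt (show c < l x from hx.1.2)]
  have hM : IsSideFunction S W f :=
    (hf₁.mono hWo fun x hx => (hsub hx).1).congr hcl fun x hx => by
      by_cases h : l x ≤ c
      · simp [f, h]
      · simp [f, h, hb x hx]
  refine ⟨_, f, fun x hx => ?_, (hL.union hM).union hR⟩
  rcases lt_trichotomy (l x) c with h | h | h
  · exact Or.inl (Or.inl ⟨hKO₁ ⟨hx, h.le⟩, h⟩)
  · exact Or.inl (Or.inr (self_subset_thickening hδ _ ⟨hx, h⟩))
  · exact Or.inr ⟨hKO₂ ⟨hx, h.le⟩, h⟩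

/-- A side function exists near a compact convex set as soon as one exists near each of its
slices by parallel hyperplanes. -/
lemma LocallySeparating.exists_of_slices (hS : LocallySeparating S) (hcl : IsClosed S)
    (hK : IsCompact K) (hconv : Convex ℝ K) (l : E →L[ℝ] ℝ)
    (h : ∀ c, ∃ O f, K ∩ {x | l x = c} ⊆ O ∧ IsSideFunction S O f) :
    ∃ O f, K ⊆ O ∧ IsSideFunction S O f := by
  choose O f hO hf using h
  obtain ⟨M, hM0, hM⟩ : ∃ M : ℝ, 0 ≤ M ∧ ∀ x ∈ K, |l x| ≤ M := by
    obtain ⟨M, hM⟩ := (hK.image l.continuous).isBounded.exists_norm_le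
    exact ⟨max M 0, le_max_right _ _,
      fun x hx => (hM _ (mem_image_of_mem _ hx)).trans (le_max_left _ _)⟩
  let V : ℝ → Set ℝ := fun c => (l '' (K \ O c))ᶜ
  have hV : ∀ c, IsOpen (V c) := fun c =>
    ((hK.diff (hf c).isOpen).image l.continuous).isClosed.isOpen_compl
  have hcV : ∀ c, c ∈ V c := by
    rintro c ⟨x, hx, rfl⟩
    exact hx.2 (hO _ ⟨hx.1, rfl⟩)
  obtain ⟨t, ht0, -, ⟨m, hm⟩, ht⟩ := exists_monotone_Icc_subset_open_cover_Icc
    (a := -M) (b := M) (by linarith) (c := fun c => Subtype.val ⁻¹' V c)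
    (fun c => (hV c).preimage continuous_subtype_val)
    (fun x _ => mem_iUnion.2 ⟨x.1, hcV x.1⟩)
  have step : ∀ n, ∃ O f, K ∩ {x | l x ≤ t n} ⊆ O ∧ IsSideFunction S O f := by
    intro n
    induction n with
    | zero =>
      obtain ⟨P, g, hP, hg⟩ : ∃ P g, K ∩ {x | l x = -M} ⊆ P ∧ IsSideFunction S P g :=
        ⟨_, _, hO _, hf _⟩
      refine ⟨P, g, fun x hx => hP ⟨hx.1, ?_⟩, hg⟩
      have h1 := (abs_le.1 (hM x hx.1)).1
      have h2 : l x ≤ t 0 := hx.2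
      rw [ht0] at h2
      exact le_antisymm h2 h1
    | succ n ih =>
      obtain ⟨i, hi⟩ := ht n
      refine hS.glue hcl (hK.inter_right (isClosed_le l.continuous continuous_const))
        (hconv.inter (convex_halfSpace_le l.toLinearMap.isLinear _)) l (t n) ?_ ?_
      · obtain ⟨P, g, hP, hg⟩ := ih
        exact ⟨P, g, fun x hx => hP ⟨hx.1.1, hx.2⟩, hg⟩
      · refine ⟨O i, f i, fun x hx => ?_, hf i⟩
        by_contra hxO
        have hx' : l x ∈ Icc (-M) M := abs_le.1 (hM x hx.1.1)
        exact hi (show (⟨l x, hx'⟩ : Icc (-M) M) ∈ Icc (t n) (t (n + 1)) from ⟨hx.2, hx.1.2⟩)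
          ⟨x, ⟨hx.1.1, hxO⟩, rfl⟩
  obtain ⟨P, g, hP, hg⟩ := step m
  refine ⟨P, g, fun x hx => hP ⟨hx, ?_⟩, hg⟩
  have : (t m : ℝ) = M := by rw [hm m le_rfl]
  exact (abs_le.1 (hM x hx)).2.trans this.ge

end Extension

/-- Near every compact convex set there is a side function of a closed locally separating set. -/
lemma LocallySeparating.exists_sideFunction {ι : Type*} [Fintype ι]
    {S K : Set (EuclideanSpace ℝ ι)} (hS : LocallySeparating S) (hcl : IsClosed S)
    (hK : IsCompact K) (hconv : Convex ℝ K) :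
    ∃ O f, K ⊆ O ∧ IsSideFunction S O f := by
  classical
  have key : ∀ (s : Finset ι) (K : Set (EuclideanSpace ℝ ι)), IsCompact K → Convex ℝ K →
      (∀ x ∈ K, ∀ y ∈ K, ∀ i ∉ s, x i = y i) → ∃ O f, K ⊆ O ∧ IsSideFunction S O f := by
    intro s
    induction s using Finset.induction_on with
    | empty =>
      intro K hK hconv hsub
      rcases K.eq_empty_or_nonempty with rfl | ⟨x, hx⟩
      · exact ⟨∅, fun _ => true, empty_subset _, isOpen_empty, by simp, by simp⟩
      have hKx : K ⊆ {x} := fun y hy => PiLp.ext fun i => hsub y hy x hx i (by simp)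
      by_cases hxS : x ∈ S
      · obtain ⟨W, A, B, h, hxW, -⟩ := hS x hxS univ univ_mem
        obtain ⟨f, hf⟩ := h.exists_sideFunction
        exact ⟨W, f, hKx.trans (singleton_subset_iff.2 hxW), hf⟩
      · exact ⟨Sᶜ, fun _ => true, hKx.trans (singleton_subset_iff.2 hxS), hcl.isOpen_compl,
          by simp, fun x hx => absurd hx.2 hx.1⟩
    | insert i s hi ih =>
      intro K hK hconv hsub
      let l : EuclideanSpace ℝ ι →L[ℝ] ℝ := EuclideanSpace.proj i
      refine hS.exists_of_slices hcl hK hconv l fun c => ?_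
      refine ih _ (hK.inter_right (isClosed_eq l.continuous continuous_const))
        (hconv.inter (convex_hyperplane l.toLinearMap.isLinear c)) fun x hx y hy j hj => ?_
      by_cases hji : j = i
      · subst hji
        exact (show x j = c from hx.2).trans (show y j = c from hy.2).symm
      · exact hsub x hx.1 y hy.1 j (by simp [hji, hj])
  exact key Finset.univ K hK hconv fun x _ y _ i hi => absurd (Finset.mem_univ i) hi

/-- The two sides of a cut lie in different components of the complement. -/
lemma LocallySeparating.connectedComponentIn_ne {ι : Type*} [Fintype ι]
    {S W A B : Set (EuclideanSpace ℝ ι)} (hS : LocallySeparating S) (hcl : IsClosed S)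
    (h : IsCut S W A B) (hW : Bornology.IsBounded W) {x a b : EuclideanSpace ℝ ι}
    (hxW : x ∈ W) (hxS : x ∈ S) (ha : a ∈ A) (hb : b ∈ B) :
    connectedComponentIn Sᶜ a ≠ connectedComponentIn Sᶜ b := by
  intro heq
  have haS : a ∈ Sᶜ := (h.left_subset ha).2
  have hpath := (hcl.isOpen_compl.connectedComponentIn (x := a)).isConnected_iff_isPathConnected.1
    (isConnected_connectedComponentIn_iff.2 haS)
  obtain ⟨γ, hγ⟩ := hpath.joinedIn a (mem_connectedComponentIn haS) b
    (heq ▸ mem_connectedComponentIn (h.right_subset hb).2)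
  have hrange : IsCompact (range γ) := isCompact_range γ.continuous
  obtain ⟨R, hR⟩ := (hrange.isBounded.union hW).subset_closedBall 0
  obtain ⟨O, f, hO, hf⟩ := hS.exists_sideFunction hcl
    (isCompact_closedBall (0 : EuclideanSpace ℝ ι) R) (convex_closedBall _ _)
  have hne := h.sideFunction_ne
    (hf.mono h.isOpen (subset_union_right.trans (hR.trans hO))) hxW hxS ha hb
  have heq' : f a = f b := by
    refine hf.eq_of_isPreconnected (T := range γ) (isPreconnected_range γ.continuous) ?_
      ⟨0, γ.source⟩ ⟨1, γ.target⟩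
    rintro _ ⟨t, rfl⟩
    exact ⟨hO (hR (Or.inl ⟨t, rfl⟩)), connectedComponentIn_subset _ _ (hγ t)⟩
  simp [heq'] at hne

/-- Every component of the complement of a connected locally separating set `S` is bounded
by all of `S`. -/
lemma LocallySeparating.frontier_component {X : Type*} [TopologicalSpace X]
    [LocallyConnectedSpace X] [PreconnectedSpace X] {S : Set X} (hS : LocallySeparating S)
    (hcl : IsClosed S) (hconn : IsConnected S) {x : X} (hx : x ∈ Sᶜ) :
    frontier (connectedComponentIn Sᶜ x) = S := by
  set C := connectedComponentIn Sᶜ x with hC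
  have hCo : IsOpen C := hcl.isOpen_compl.connectedComponentIn
  have hCS : C ⊆ Sᶜ := connectedComponentIn_subset _ _
  have hxC : x ∈ C := mem_connectedComponentIn hx
  have hfr : frontier C ⊆ S := by
    intro y hy
    by_contra hyS
    rw [hCo.frontier_eq] at hy
    obtain ⟨z, hz, hzC⟩ := mem_closure_iff.1 hy.1 _
      (hcl.isOpen_compl.connectedComponentIn (x := y)) (mem_connectedComponentIn hyS)
    have hxy : C = connectedComponentIn Sᶜ y :=
      (connectedComponentIn_eq hzC).trans (connectedComponentIn_eq hz).symm
    exact hy.2 (hxy ▸ mem_connectedComponentIn hyS)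
  refine hfr.antisymm fun y hy => ?_
  rw [hCo.frontier_eq]
  refine ⟨?_, fun hyC => hCS hyC hy⟩
  have hne : (frontier C).Nonempty := by
    rw [nonempty_iff_ne_empty, Ne, ← isClopen_iff_frontier_eq_empty]
    intro hclopen
    have := hclopen.eq_univ ⟨x, hxC⟩
    obtain ⟨s, hs⟩ := hconn.nonempty
    exact hCS (this ▸ mem_univ s) hs
  obtain ⟨s, hs⟩ := hne
  by_contra hyC
  let u : Set X := {z | ∀ᶠ w in 𝓝 z, w ∈ S → w ∈ closure C}
  have hu : IsOpen u := isOpen_setOfPred_eventually_nhds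
  have hSu : ∀ z ∈ S, z ∈ closure C → z ∈ u := by
    intro z hzS hz
    obtain ⟨W, A, B, h, hzW, -⟩ := hS z hzS univ univ_mem
    obtain ⟨w, hwW, hwC⟩ := mem_closure_iff.1 hz W h.isOpen hzW
    have hW : W ∩ S ⊆ closure C := by
      have hw : w ∈ A ∪ B := h.union_eq ▸ ⟨hwW, hCS hwC⟩
      rw [hC, connectedComponentIn_eq hwC]
      rcases hw with hw | hw
      · exact h.subset_closure_left.trans (closure_mono
          (h.left_preconnected.subset_connectedComponentIn hw fun a ha => (h.left_subset ha).2))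
      · exact h.subset_closure_right.trans (closure_mono
          (h.right_preconnected.subset_connectedComponentIn hw fun a ha => (h.right_subset ha).2))
    filter_upwards [h.isOpen.mem_nhds hzW] with w hw hwS using hW ⟨hw, hwS⟩
  obtain ⟨w, hwS, hwu, hwC⟩ := hconn.isPreconnected u (closure C)ᶜ hu isClosed_closure.isOpen_compl
    (fun z hz => (em (z ∈ closure C)).imp (hSu z hz) id)
    ⟨s, hfr hs, hSu s (hfr hs) (frontier_subset_closure hs)⟩ ⟨y, hy, hyC⟩
  exact hwC (Eventually.self_of_nhds (show ∀ᶠ w in 𝓝 w, w ∈ S → w ∈ closure C from hwu) hwS)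

/-- The complement of a closed ball centered at the origin is connected in dimension at least
two. -/
lemma isPreconnected_compl_closedBall_zero {E : Type*} [NormedAddCommGroup E] [NormedSpace ℝ E]
    (h : 1 < Module.rank ℝ E) {R : ℝ} (hR : 0 ≤ R) : IsPreconnected (closedBall (0 : E) R)ᶜ := by
  have himg : (closedBall (0 : E) R)ᶜ = (fun p : ℝ × E => p.1 • p.2) '' (Ioi R ×ˢ sphere 0 1) := by
    ext x
    simp only [mem_compl_iff, mem_closedBall, dist_zero_right, not_le]
    constructor
    · intro hx
      have hx0 : ‖x‖ ≠ 0 := (hR.trans_lt hx).ne'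
      exact ⟨(‖x‖, ‖x‖⁻¹ • x), ⟨hx, by simp [norm_smul, hx0]⟩, by simp [smul_smul, hx0]⟩
    · rintro ⟨⟨r, v⟩, ⟨hr, hv⟩, rfl⟩
      have hr' : R < r := hr
      have hv' : ‖v‖ = 1 := by simpa using hv
      simpa [norm_smul, hv', abs_of_pos (hR.trans_lt hr')] using hr'
  rw [himg]
  exact (isPreconnected_Ioi.prod (isPreconnected_sphere h 0 1)).image _ (by fun_prop)

/-- Every point of the hyperplane `{z | z i = 0}` in a ball is a limit of points of the ball on
a prescribed side of the hyperplane. -/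
lemma mem_closure_ball_inter_preimage {ι : Type*} [Fintype ι] {i : ι}
    {c z : EuclideanSpace ℝ ι} {r : ℝ} (hz : z ∈ ball c r) (hzi : z i = 0) {T : Set ℝ}
    (hT : (0 : ℝ) ∈ closure T) : z ∈ closure (ball c r ∩ {y | y i ∈ T}) := by
  classical
  refine isOpen_ball.inter_closure ⟨hz, ?_⟩
  let φ : ℝ → EuclideanSpace ℝ ι := fun t => z + t • EuclideanSpace.single i (1 : ℝ)
  have hφ : Continuous φ := by fun_prop
  have h0 : φ 0 = z := by simp [φ]
  rw [← h0]
  refine closure_mono ?_ (mem_closure_image hφ.continuousAt hT)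
  rintro _ ⟨t, ht, rfl⟩
  simpa [φ, hzi] using ht

/-- A locally flat hypersurface locally separates. -/
lemma locallySeparating_of_charts {ι : Type*} [Fintype ι] (i : ι)
    {S : Set (EuclideanSpace ℝ ι)}
    (hsub : ∀ x ∈ S, ∃ (U V : Set (EuclideanSpace ℝ ι))
      (h g : EuclideanSpace ℝ ι → EuclideanSpace ℝ ι),
        IsOpen U ∧ x ∈ U ∧ IsOpen V ∧ ContinuousOn h U ∧ ContinuousOn g V ∧
        (∀ y ∈ U, g (h y) = y) ∧ (∀ z ∈ V, h (g z) = z) ∧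
        h '' U = V ∧ h '' (U ∩ S) = V ∩ {y | y i = 0}) :
    LocallySeparating S := by
  intro x hx O hO
  obtain ⟨U, V, h, g, hU, hxU, hV, hh, hg, hgh, hhg, hUV, hUS⟩ := hsub x hx
  have hhU : ∀ y ∈ U, h y ∈ V := fun y hy => hUV ▸ mem_image_of_mem h hy
  have hgV : ∀ z ∈ V, g z ∈ U := by
    intro z hz
    rw [← hUV] at hz
    obtain ⟨y, hy, rfl⟩ := hz
    rwa [hgh y hy]
  have hiff : ∀ y ∈ U, y ∈ S ↔ h y i = 0 := by
    intro y hy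
    constructor
    · intro hyS
      have : h y ∈ h '' (U ∩ S) := mem_image_of_mem h ⟨hy, hyS⟩
      rw [hUS] at this
      exact this.2
    · intro hy0
      have : h y ∈ h '' (U ∩ S) := hUS ▸ ⟨hhU y hy, hy0⟩
      obtain ⟨y', ⟨hy'U, hy'S⟩, hyy'⟩ := this
      rwa [← hgh y hy, ← hyy', hgh y' hy'U]
  have hgO : g ⁻¹' O ∈ 𝓝 (h x) := by
    refine (hg.continuousAt (hV.mem_nhds (hhU x hxU))).preimage_mem_nhds ?_
    rwa [hgh x hxU]
  obtain ⟨r, hr, hball⟩ := Metric.mem_nhds_iff.1 (inter_mem (hV.mem_nhds (hhU x hxU)) hgO)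
  have hballV : ball (h x) r ⊆ V := fun z hz => (hball hz).1
  let side : Set ℝ → Set (EuclideanSpace ℝ ι) := fun T => U ∩ h ⁻¹' (ball (h x) r ∩ {y | y i ∈ T})
  have hproj : Continuous fun y : EuclideanSpace ℝ ι => y i := by fun_prop
  have hside_open : ∀ T, IsOpen T → IsOpen (side T) := fun T hT =>
    hh.isOpen_inter_preimage hU (isOpen_ball.inter (hT.preimage hproj))
  have hside_eq : ∀ T, side T = g '' (ball (h x) r ∩ {y | y i ∈ T}) := by
    intro T
    ext y
    constructor
    · rintro ⟨hyU, hy⟩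
      exact ⟨h y, hy, hgh y hyU⟩
    · rintro ⟨z, hz, rfl⟩
      exact ⟨hgV z (hballV hz.1), by simpa [hhg z (hballV hz.1)] using hz⟩
  have hside_conn : ∀ T, Convex ℝ T → IsPreconnected (side T) := by
    intro T hT
    rw [hside_eq]
    refine (((convex_ball _ _).inter ?_).isPreconnected).image _
      (hg.mono (inter_subset_left.trans hballV))
    exact hT.linear_preimage
      (EuclideanSpace.proj (𝕜 := ℝ) i : EuclideanSpace ℝ ι →L[ℝ] ℝ).toLinearMap
  have hside_cl : ∀ T : Set ℝ, (0 : ℝ) ∈ closure T → side univ ∩ S ⊆ closure (side T) := by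
    rintro T hT y ⟨⟨hyU, hyb, -⟩, hyS⟩
    rw [hside_eq, ← hgh y hyU]
    exact mem_closure_image (hg.continuousAt (hV.mem_nhds (hhU y hyU)))
      (mem_closure_ball_inter_preimage hyb ((hiff y hyU).1 hyS) hT)
  refine ⟨side univ, side (Ioi 0), side (Iio 0), ⟨hside_open _ isOpen_univ,
    hside_open _ isOpen_Ioi, hside_open _ isOpen_Iio, hside_conn _ (convex_Ioi 0),
    hside_conn _ (convex_Iio 0), ?_, ?_, hside_cl _ (by simp), hside_cl _ (by simp)⟩, ?_, ?_⟩
  · rw [Set.disjoint_left]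
    exact fun y hy hy' => lt_asymm (show 0 < h y i from hy.2.2) hy'.2.2
  · ext y
    constructor
    · rintro (hy | hy)
      · exact ⟨⟨hy.1, hy.2.1, mem_univ _⟩,
          fun hyS => (show 0 < h y i from hy.2.2).ne' ((hiff y hy.1).1 hyS)⟩
      · exact ⟨⟨hy.1, hy.2.1, mem_univ _⟩,
          fun hyS => (show h y i < 0 from hy.2.2).ne ((hiff y hy.1).1 hyS)⟩
    · rintro ⟨hy, hyS⟩
      rcases lt_trichotomy (h y i) 0 with h0 | h0 | h0
      · exact Or.inr ⟨hy.1, hy.2.1, h0⟩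
      · exact absurd ((hiff y hy.1).2 h0) hyS
      · exact Or.inl ⟨hy.1, hy.2.1, h0⟩
  · exact ⟨hxU, mem_ball_self hr, mem_univ _⟩
  · rintro y ⟨hyU, hyb, -⟩
    rw [← hgh y hyU]
    exact (hball hyb).2

/-- (Jordan–Brouwer separation.) Let `N ≥ 2` and let `S ⊂ ℝ^N` be a
nonempty compact connected set which is a locally flatly embedded topological hypersurface
(every point of `S` has a neighborhood `U` and a homeomorphism `h` from `U` onto an open set
`V` with `h(U ∩ S) = V ∩ (ℝ^{N−1} × {0})`). Then `ℝ^N \ S` has exactly two connected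
components, one bounded and one unbounded, and the frontier of each of them is `S`. -/
theorem jordan_brouwer_separation (N : ℕ) (hN : 2 ≤ N)
    (S : Set (EuclideanSpace ℝ (Fin N)))
    (hne : S.Nonempty) (hcomp : IsCompact S) (hconn : IsConnected S)
    (hsub : ∀ x ∈ S,
      ∃ (U V : Set (EuclideanSpace ℝ (Fin N)))
        (h g : EuclideanSpace ℝ (Fin N) → EuclideanSpace ℝ (Fin N)),
        IsOpen U ∧ x ∈ U ∧ IsOpen V ∧
        ContinuousOn h U ∧ ContinuousOn g V ∧
        (∀ y ∈ U, g (h y) = y) ∧ (∀ z ∈ V, h (g z) = z) ∧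
        h '' U = V ∧
        h '' (U ∩ S) = V ∩ {y : EuclideanSpace ℝ (Fin N) | y ⟨N - 1, by omega⟩ = 0}) :
    ∃ B U : Set (EuclideanSpace ℝ (Fin N)),
      (∀ x ∈ Sᶜ, connectedComponentIn Sᶜ x = B ∨ connectedComponentIn Sᶜ x = U) ∧
      (∃ x ∈ Sᶜ, connectedComponentIn Sᶜ x = B) ∧
      (∃ x ∈ Sᶜ, connectedComponentIn Sᶜ x = U) ∧
      B ≠ U ∧
      Bornology.IsBounded B ∧
      ¬ Bornology.IsBounded U ∧
      frontier B = S ∧ frontier U = S := by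
  have hS : LocallySeparating S := locallySeparating_of_charts _ hsub
  have hcl := hcomp.isClosed
  have hrank : 1 < Module.rank ℝ (EuclideanSpace ℝ (Fin N)) := by
    rw [← Module.finrank_eq_rank, finrank_euclideanSpace_fin]
    exact_mod_cast hN
  obtain ⟨x₀, hx₀⟩ := hne
  obtain ⟨W, A, B, hcut, hxW, hWball⟩ := hS x₀ hx₀ _ (ball_mem_nhds x₀ one_pos)
  obtain ⟨a, ha⟩ := hcut.left_nonempty hxW hx₀
  obtain ⟨b, hb⟩ := hcut.right_nonempty hxW hx₀
  have haS : a ∈ Sᶜ := (hcut.left_subset ha).2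
  have hbS : b ∈ Sᶜ := (hcut.right_subset hb).2
  have hab : connectedComponentIn Sᶜ a ≠ connectedComponentIn Sᶜ b :=
    hS.connectedComponentIn_ne hcl hcut (isBounded_ball.subset hWball) hxW hx₀ ha hb
  have hfr : ∀ x ∈ Sᶜ, frontier (connectedComponentIn Sᶜ x) = S :=
    fun x hx => hS.frontier_component hcl hconn hx
  have htwo : ∀ x ∈ Sᶜ, connectedComponentIn Sᶜ x = connectedComponentIn Sᶜ a ∨
      connectedComponentIn Sᶜ x = connectedComponentIn Sᶜ b := by
    intro x hx
    have hx₀cl : x₀ ∈ closure (connectedComponentIn Sᶜ x) :=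
      frontier_subset_closure ((hfr x hx).symm ▸ hx₀)
    obtain ⟨w, hwW, hwC⟩ := mem_closure_iff.1 hx₀cl W hcut.isOpen hxW
    have hw : w ∈ A ∪ B := hcut.union_eq ▸ ⟨hwW, connectedComponentIn_subset _ _ hwC⟩
    rw [connectedComponentIn_eq hwC]
    rcases hw with hw | hw
    · exact Or.inl (connectedComponentIn_eq (hcut.left_preconnected.subset_connectedComponentIn hw
        (fun y hy => (hcut.left_subset hy).2) ha))
    · exact Or.inr (connectedComponentIn_eq (hcut.right_preconnected.subset_connectedComponentIn hw
        (fun y hy => (hcut.right_subset hy).2) hb))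
  obtain ⟨R, hR0, hR⟩ : ∃ R : ℝ, 0 ≤ R ∧ S ⊆ closedBall 0 R := by
    obtain ⟨R, hR⟩ := hcomp.isBounded.subset_closedBall 0
    exact ⟨max R 0, le_max_right _ _, hR.trans (closedBall_subset_closedBall (le_max_left _ _))⟩
  have : Nontrivial (EuclideanSpace ℝ (Fin N)) := ⟨a, b, fun h => hab (h ▸ rfl)⟩
  have hunb : ¬ Bornology.IsBounded (closedBall (0 : EuclideanSpace ℝ (Fin N)) R)ᶜ := fun h =>
    NormedSpace.unbounded_univ ℝ (EuclideanSpace ℝ (Fin N))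
      (union_compl_self (closedBall (0 : EuclideanSpace ℝ (Fin N)) R) ▸ isBounded_closedBall.union h)
  obtain ⟨p, hp⟩ : (closedBall (0 : EuclideanSpace ℝ (Fin N)) R)ᶜ.Nonempty := by
    rw [nonempty_iff_ne_empty]
    intro h
    exact hunb (h ▸ Bornology.isBounded_empty)
  have hpS : p ∈ Sᶜ := fun h => hp (hR h)
  have hsubp : (closedBall 0 R)ᶜ ⊆ connectedComponentIn Sᶜ p :=
    (isPreconnected_compl_closedBall_zero hrank hR0).subset_connectedComponentIn hp
      (compl_subset_compl.2 hR)
  have hpunb : ¬ Bornology.IsBounded (connectedComponentIn Sᶜ p) := fun h => hunb (h.subset hsubp)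
  have hbdd : ∀ x, connectedComponentIn Sᶜ x ≠ connectedComponentIn Sᶜ p →
      Bornology.IsBounded (connectedComponentIn Sᶜ x) := by
    intro x hxp
    refine (isBounded_closedBall (x := (0 : EuclideanSpace ℝ (Fin N))) (r := R)).subset ?_
    intro y hy
    by_contra hyR
    exact hxp ((connectedComponentIn_eq hy).trans (connectedComponentIn_eq (hsubp hyR)).symm)
  rcases htwo p hpS with hpa | hpb
  · exact ⟨_, _, fun x hx => (htwo x hx).symm, ⟨b, hbS, rfl⟩, ⟨a, haS, rfl⟩, hab.symm,
      hbdd b (hpa ▸ hab.symm), hpa ▸ hpunb, hfr b hbS, hfr a haS⟩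
  · exact ⟨_, _, htwo, ⟨a, haS, rfl⟩, ⟨b, hbS, rfl⟩, hab,
      hbdd a (hpb ▸ hab), hpb ▸ hpunb, hfr a haS, hfr b hbS⟩
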